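/- Let H be a real Hilbert space and let m < 1 be a real number. For every measurable ω : (0,1) → H with ∫₀¹ ‖ω(s)‖² s^m ds < ∞, the function r ↦ ∫₀^r ω(s) ds (a Bochner integral) satisfies the Hardy-type inequality ∫₀¹ ‖∫₀^r ω(s) ds‖² r^m dr ≤ (1/(2(1-m))) · ∫₀¹ ‖ω(s)‖² s^m ds. -/

import Mathlib

open MeasureTheory Set

/-- Cauchy–Schwarz for the lower Lebesgue integral. -/
lemma sq_lintegral_mul_le {α : Type*} [MeasurableSpace α] {μ : Measure α}
    {f g : α → ENNReal} (hf : AEMeasurable f μ) (hg : AEMeasurable g μ) :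
    (∫⁻ x, f x * g x ∂μ) ^ 2 ≤ (∫⁻ x, f x ^ 2 ∂μ) * ∫⁻ x, g x ^ 2 ∂μ := by
  have h := ENNReal.lintegral_mul_le_Lp_mul_Lq μ Real.HolderConjugate.two_two hf hg
  simp only [Pi.mul_apply, ENNReal.rpow_two] at h
  calc (∫⁻ x, f x * g x ∂μ) ^ 2
      ≤ ((∫⁻ x, f x ^ 2 ∂μ) ^ (1 / 2 : ℝ) * (∫⁻ x, g x ^ 2 ∂μ) ^ (1 / 2 : ℝ)) ^ 2 := by gcongr
    _ = _ := by
      rw [mul_pow, ← ENNReal.rpow_two, ← ENNReal.rpow_two, ← ENNReal.rpow_mul,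
        ← ENNReal.rpow_mul]
      norm_num

lemma lintegral_Ioc_rpow {p r : ℝ} (hp : -1 < p) (hr : 0 ≤ r) :
    ∫⁻ s in Ioc 0 r, ENNReal.ofReal (s ^ p) = ENNReal.ofReal (r ^ (p + 1) / (p + 1)) := by
  have hint : IntegrableOn (fun s : ℝ ↦ s ^ p) (Ioc 0 r) :=
    (intervalIntegrable_iff_integrableOn_Ioc_of_le hr).1
      (intervalIntegral.intervalIntegrable_rpow' hp)
  have hnonneg : 0 ≤ᵐ[volume.restrict (Ioc 0 r)] fun s : ℝ ↦ s ^ p :=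
    (ae_restrict_mem measurableSet_Ioc).mono fun s hs ↦ Real.rpow_nonneg hs.1.le p
  rw [← ofReal_integral_eq_lintegral_ofReal hint hnonneg,
    ← intervalIntegral.integral_of_le hr, integral_rpow (Or.inl hp),
    Real.zero_rpow (by linarith), sub_zero]

/-- Pointwise weighted bound for a primitive of a vector-valued function. -/
lemma sq_norm_integral_mul_rpow_le {E : Type*} [NormedAddCommGroup E] [NormedSpace ℝ E]
    {m r : ℝ} (hm : m < 1) (hr : 0 < r) {ω : ℝ → E} (hω : StronglyMeasurable ω) :
    ENNReal.ofReal (‖∫ s in (0:ℝ)..r, ω s‖ ^ 2 * r ^ m) ≤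
      ENNReal.ofReal (r / (1 - m)) *
        ∫⁻ s in Ioc 0 r, ENNReal.ofReal (‖ω s‖ ^ 2 * s ^ m) := by
  have hnorm : ‖∫ s in (0:ℝ)..r, ω s‖ₑ ≤
      ∫⁻ s in Ioc 0 r,
        ENNReal.ofReal (s ^ (-m / 2)) * ENNReal.ofReal (‖ω s‖ * s ^ (m / 2)) := by
    rw [intervalIntegral.integral_of_le hr.le]
    refine (enorm_integral_le_lintegral_enorm _).trans_eq
      (setLIntegral_congr_fun measurableSet_Ioc fun s hs ↦ ?_)
    have hs0 : 0 < s := hs.1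
    rw [← ENNReal.ofReal_mul (by positivity), mul_left_comm, ← Real.rpow_add hs0,
      neg_div, neg_add_cancel, Real.rpow_zero, mul_one, ofReal_norm]
  have hsq : ‖∫ s in (0:ℝ)..r, ω s‖ₑ ^ 2 ≤ ENNReal.ofReal (r ^ (1 - m) / (1 - m)) *
      ∫⁻ s in Ioc 0 r, ENNReal.ofReal (‖ω s‖ ^ 2 * s ^ m) := by
    refine (pow_le_pow_left' hnorm 2).trans ((sq_lintegral_mul_le
      (by fun_prop) ?_).trans_eq ?_)
    · have := hω.norm.measurable
      fun_prop
    · rw [show 1 - m = -m + 1 by ring, ← lintegral_Ioc_rpow (by linarith) hr.le]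
      congr 1 <;> refine setLIntegral_congr_fun measurableSet_Ioc fun s hs ↦ ?_
      all_goals
        have hs0 : 0 < s := hs.1
        rw [← ENNReal.ofReal_pow (by positivity)]
      · rw [← Real.rpow_mul_natCast hs0.le]
        norm_num
      · rw [mul_pow, ← Real.rpow_mul_natCast hs0.le]
        norm_num
  calc ENNReal.ofReal (‖∫ s in (0:ℝ)..r, ω s‖ ^ 2 * r ^ m)
      = ‖∫ s in (0:ℝ)..r, ω s‖ₑ ^ 2 * ENNReal.ofReal (r ^ m) := by
        rw [ENNReal.ofReal_mul (by positivity), ENNReal.ofReal_pow (by positivity), ofReal_norm]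
    _ ≤ ENNReal.ofReal (r ^ (1 - m) / (1 - m)) *
          (∫⁻ s in Ioc 0 r, ENNReal.ofReal (‖ω s‖ ^ 2 * s ^ m)) * ENNReal.ofReal (r ^ m) := by
        gcongr
    _ = _ := by
        rw [mul_right_comm, ← ENNReal.ofReal_mul
          (div_nonneg (by positivity) (by linarith)), div_mul_eq_mul_div, ← Real.rpow_add hr,
          sub_add_cancel, Real.rpow_one]

/-- Hardy-type inequality: for `m < 1` and `ω` in the weighted space `L²_m`,
`∫₀¹ ‖∫₀^r ω(s) ds‖² r^m dr ≤ (1/(2(1-m))) ∫₀¹ ‖ω(s)‖² s^m ds`. -/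
theorem hardy_homotopy_bound {H : Type*} [NormedAddCommGroup H]
    [InnerProductSpace ℝ H] [CompleteSpace H] (m : ℝ) (hm : m < 1)
    (ω : ℝ → H) (hω : StronglyMeasurable ω)
    (hL2 : (∫⁻ s in Ioo (0:ℝ) 1, ENNReal.ofReal (‖ω s‖ ^ 2 * s ^ m)) < ⊤) :
    (∫⁻ r in Ioo (0:ℝ) 1, ENNReal.ofReal (‖∫ s in (0:ℝ)..r, ω s‖ ^ 2 * r ^ m)) ≤
      ENNReal.ofReal (1 / (2 * (1 - m))) *
        ∫⁻ s in Ioo (0:ℝ) 1, ENNReal.ofReal (‖ω s‖ ^ 2 * s ^ m) := by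
  have hm' : 0 < 1 - m := sub_pos.2 hm
  set A := ∫⁻ s in Ioo (0:ℝ) 1, ENNReal.ofReal (‖ω s‖ ^ 2 * s ^ m)
  calc (∫⁻ r in Ioo (0:ℝ) 1, ENNReal.ofReal (‖∫ s in (0:ℝ)..r, ω s‖ ^ 2 * r ^ m))
      ≤ ∫⁻ r in Ioo (0:ℝ) 1, ENNReal.ofReal (r ^ (1:ℝ)) * (ENNReal.ofReal (1 / (1 - m)) * A) := by
        refine setLIntegral_mono' measurableSet_Ioo fun r hr ↦ ?_
        refine (sq_norm_integral_mul_rpow_le hm hr.1 hω).trans ?_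
        rw [Real.rpow_one, ← mul_assoc, ← ENNReal.ofReal_mul hr.1.le, mul_one_div]
        gcongr
        exact lintegral_mono_set fun s hs ↦ ⟨hs.1, hs.2.trans_lt hr.2⟩
    _ = ENNReal.ofReal (1 / (2 * (1 - m))) * A := by
        rw [lintegral_mul_const' _ _ (ENNReal.mul_ne_top ENNReal.ofReal_ne_top hL2.ne),
          setLIntegral_congr Ioo_ae_eq_Ioc, lintegral_Ioc_rpow (by norm_num) zero_le_one,
          ← mul_assoc, ← ENNReal.ofReal_mul (by positivity)]
        congr 2
        rw [Real.one_rpow]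
        field_simp
        norm_num
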